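/- Let n ≥ 1, f : {1,−1}^n → ℝ with all influences I_j ≥ 0, let κ > 0, and for each j let Ω_j, Ω_j' ⊆ {1,−1}^n be sets depending only on ε_1,…,ε_{j−1} and on ε_{j+1},…,ε_n respectively, with I_j ≥ κ on Ω_j ∩ Ω_j'. Set Ω̃ = ∩_{1≤j≤n} (Ω_j ∩ Ω_j'). Then for every t ∈ ℝ the set { ε ∈ Ω̃ : |f(ε) − t| < κ/2 } contains no two distinct elements that are comparable in the coordinatewise partial order; i.e., it is an antichain in {1,−1}^n. -/

import Mathlib

noncomputable section

/-- The `j`-th influence of `f : {1,-1}^n → ℝ` (cube encoded as `Fin n → Bool`,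
`true ↔ 1`, `false ↔ -1`): `I_j(ε) = f|_{ε_j = 1} - f|_{ε_j = -1}`. -/
def influence {n : ℕ} (f : (Fin n → Bool) → ℝ) (j : Fin n) (ε : Fin n → Bool) : ℝ :=
  f (Function.update ε j true) - f (Function.update ε j false)

/-- `S ⊆ {1,-1}^n` depends only on the variables `ε_k` for `k < j`. -/
def DependsOnLt {n : ℕ} (S : Set (Fin n → Bool)) (j : Fin n) : Prop :=
  ∀ ε ε' : Fin n → Bool, (∀ k : Fin n, k < j → ε k = ε' k) → (ε ∈ S ↔ ε' ∈ S)

/-- `S ⊆ {1,-1}^n` depends only on the variables `ε_k` for `k > j`. -/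
def DependsOnGt {n : ℕ} (S : Set (Fin n → Bool)) (j : Fin n) : Prop :=
  ∀ ε ε' : Fin n → Bool, (∀ k : Fin n, j < k → ε k = ε' k) → (ε ∈ S ↔ ε' ∈ S)

/-- A function on the cube with nonnegative influences is monotone. -/
theorem monotone_of_influence_nonneg {n : ℕ} {f : (Fin n → Bool) → ℝ}
    (hf : ∀ (j : Fin n) (ε : Fin n → Bool), 0 ≤ influence f j ε) : Monotone f := by
  intro ε ε' hle
  suffices h : ∀ s : Finset (Fin n), f ε ≤ f (s.piecewise ε' ε) by
    simpa using h Finset.univ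
  intro s
  induction s using Finset.induction_on with
  | empty => simp
  | insert j s hj ih =>
    rw [Finset.piecewise_insert]
    refine ih.trans ?_
    have hs : s.piecewise ε' ε j = ε j := Finset.piecewise_eq_of_notMem _ _ _ hj
    have hinf := hf j (s.piecewise ε' ε)
    unfold influence at hinf
    have hself := Function.update_eq_self j (s.piecewise ε' ε)
    rw [hs] at hself
    have hlej : ε j ≤ ε' j := hle j
    cases h : ε j <;> cases h' : ε' j <;> rw [h] at hself <;> rw [h, h'] at hlej
    · rw [hself]
    · rw [hself] at hinf
      linarith
    · exact absurd hlej (by decide)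
    · rw [hself]

/-- With hypotheses as in Lemma 1, the set `{ε ∈ Ω̃ : |f(ε) - t| < κ/2}`,
where `Ω̃ = ⋂_j (Ω_j ∩ Ω_j')`, is an antichain for the coordinatewise partial
order on the cube (with `-1 < 1`, i.e. `false < true`). -/
theorem level_set_is_antichain
    (n : ℕ) (hn : 1 ≤ n)
    (f : (Fin n → Bool) → ℝ) (κ : ℝ) (hκ : 0 < κ)
    (Ω Ω' : Fin n → Set (Fin n → Bool))
    (hmono : ∀ (j : Fin n) (ε : Fin n → Bool), 0 ≤ influence f j ε)
    (hΩ : ∀ j : Fin n, DependsOnLt (Ω j) j)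
    (hΩ' : ∀ j : Fin n, DependsOnGt (Ω' j) j)
    (hinf : ∀ (j : Fin n) (ε : Fin n → Bool), ε ∈ Ω j ∩ Ω' j → κ ≤ influence f j ε)
    (t : ℝ) :
    ∀ ε ε' : Fin n → Bool,
      ε ∈ ⋂ j : Fin n, (Ω j ∩ Ω' j) → ε' ∈ ⋂ j : Fin n, (Ω j ∩ Ω' j) →
      |f ε - t| < κ / 2 → |f ε' - t| < κ / 2 →
      (∀ j : Fin n, ε j ≤ ε' j) → ε = ε' := by
  intro ε ε' hε hε' hft hft' hle
  have hf : Monotone f := monotone_of_influence_nonneg hmono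
  rw [Set.mem_iInter] at hε hε'
  by_contra hne
  obtain ⟨j, hj⟩ := Function.ne_iff.mp hne
  obtain ⟨hjε, hjε'⟩ : ε j = false ∧ ε' j = true := by
    have hlej : ε j ≤ ε' j := hle j
    revert hj hlej
    cases ε j <;> cases ε' j <;> decide
  set η : Fin n → Bool := fun k => if k < j then ε k else ε' k with hη
  have hηΩ : η ∈ Ω j := (hΩ j ε η fun k hk => by simp [hη, hk]).mp (hε j).1
  have hηΩ' : η ∈ Ω' j := (hΩ' j ε' η fun k hk => by simp [hη, hk.not_gt]).mp (hε' j).2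
  have hκη := hinf j η ⟨hηΩ, hηΩ'⟩
  have hη_le : η ≤ ε' := fun k => by
    simp only [hη]
    split_ifs
    exacts [hle k, le_rfl]
  have hle_η : ε ≤ η := fun k => by
    simp only [hη]
    split_ifs
    exacts [le_rfl, hle k]
  have htop : f (Function.update η j true) ≤ f ε' :=
    hf (update_le_iff.mpr ⟨hjε'.ge, fun k _ => hη_le k⟩)
  have hbot : f ε ≤ f (Function.update η j false) :=
    hf (le_update_iff.mpr ⟨hjε.le, fun k _ => hle_η k⟩)
  unfold influence at hκη
  rw [abs_lt] at hft hft'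
  linarith [hft.1, hft'.2]
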